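/- Let n ≥ 1, 1 ≤ r ≤ n, and 1 ≤ k ≤ n be integers, and let Z = (Z_1,…,Z_n) be uniformly distributed on the Hamming ball B_r ⊆ {-1,1}^n. Then 2·P[Z_1·Z_2···Z_k = 1] − 1 = K_r^{(n−1)}(k−1) / C(n,≤r). -/

import Mathlib

open Finset

noncomputable section

/-- The Hamming ball of radius `r` around the all-ones vector in `{-1,1}^n`
(vertices modeled as `Fin n → ℤˣ`, where `ℤˣ = {1, -1}`). -/
def hBall (n r : ℕ) : Finset (Fin n → ℤˣ) :=
  Finset.univ.filter fun z => hammingDist z 1 ≤ r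

/-- The Hamming sphere of radius `r` around the all-ones vector. -/
def hSphere (n r : ℕ) : Finset (Fin n → ℤˣ) :=
  Finset.univ.filter fun z => hammingDist z 1 = r

/-- Ball-noise stability `E[f(X) f(X∘Z)]`, `X` uniform on the cube, `Z` uniform on `B_r`. -/
def BStab (n r : ℕ) (f : (Fin n → ℤˣ) → ℝ) : ℝ :=
  (∑ x : Fin n → ℤˣ, ∑ z ∈ hBall n r, f x * f (x * z)) / (2 ^ n * (hBall n r).card)

/-- Sphere-noise stability `E[f(X) f(X∘Z)]`, `X` uniform on the cube, `Z` uniform on `S_r`. -/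
def SStab (n r : ℕ) (f : (Fin n → ℤˣ) → ℝ) : ℝ :=
  (∑ x : Fin n → ℤˣ, ∑ z ∈ hSphere n r, f x * f (x * z)) / (2 ^ n * (hSphere n r).card)

/-- i.i.d.-noise stability `E[f(X) f(X∘Z)]`, `Z` with i.i.d. coordinates equal to `-1`
with probability `β` and `1` with probability `1-β`. -/
def Stab (n : ℕ) (β : ℝ) (f : (Fin n → ℤˣ) → ℝ) : ℝ :=
  (∑ x : Fin n → ℤˣ, ∑ z : Fin n → ℤˣ,
      (∏ i, if z i = 1 then 1 - β else β) * (f x * f (x * z))) / 2 ^ n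

/-- Indicator function of a set `A` of vertices. -/
def indic (n : ℕ) (A : Finset (Fin n → ℤˣ)) : (Fin n → ℤˣ) → ℝ :=
  fun x => if x ∈ A then 1 else 0

/-- `Γ_B^(n)(M,r)`: maximal ball-noise stability over Boolean functions with exactly `M` ones. -/
def GammaB (n M r : ℕ) : ℝ :=
  sSup {y | ∃ A : Finset (Fin n → ℤˣ), A.card = M ∧ y = BStab n r (indic n A)}

/-- `Γ_S^(n)(M,r)`: maximal sphere-noise stability over Boolean functions with exactly `M` ones. -/
def GammaS (n M r : ℕ) : ℝ :=
  sSup {y | ∃ A : Finset (Fin n → ℤˣ), A.card = M ∧ y = SStab n r (indic n A)}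

/-- `Γ_IID^(n)(M,β)`: maximal i.i.d.-noise stability over Boolean functions with exactly `M` ones. -/
def GammaIID (n M : ℕ) (β : ℝ) : ℝ :=
  sSup {y | ∃ A : Finset (Fin n → ℤˣ), A.card = M ∧ y = Stab n β (indic n A)}

/-- `Γ_IID(α,β) := sup_n Γ_IID^(n)(⌊α·2^n⌋, β)` (equivalently the limit, by monotonicity). -/
def GammaIIDlim (α β : ℝ) : ℝ := ⨆ n : ℕ, GammaIID n ⌊α * 2 ^ n⌋₊ β

/-- `C(n, ≤ r) = Σ_{i=0}^r C(n,i)`. -/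
def ballBinom (n r : ℕ) : ℕ := ∑ i ∈ Finset.range (r + 1), n.choose i

/-- Generalized binomial coefficient `C(x, j) = x(x-1)⋯(x-j+1)/j!` for real `x`. -/
def rchoose (x : ℝ) (j : ℕ) : ℝ := (∏ i ∈ Finset.range j, (x - i)) / (Nat.factorial j)

/-- Krawtchouk polynomial `K_k^(n)(x) = Σ_{j=0}^k (-1)^j C(x,j) C(n-x, k-j)`. -/
def kraw (n k : ℕ) (x : ℝ) : ℝ :=
  ∑ j ∈ Finset.range (k + 1), (-1 : ℝ) ^ j * rchoose x j * rchoose ((n : ℝ) - x) (k - j)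

open Polynomial in
/-- The weight enumerator of the character `z ↦ ∏ i ∈ s, z i` on `{-1,1}^n`. -/
theorem sum_character_mul_X_pow_hammingDist {n : ℕ} (s : Finset (Fin n)) :
    ∑ z : Fin n → ℤˣ, C (∏ i ∈ s, ((z i : ℤ) : ℝ)) * X ^ hammingDist z 1
      = (1 - X) ^ #s * (1 + X) ^ (n - #s) := by
  let f : Fin n → ℤˣ → ℝ[X] := fun i u =>
    (if i ∈ s then C ((u : ℤ) : ℝ) else 1) * (if u ≠ 1 then X else 1)
  have hf : ∀ z : Fin n → ℤˣ,
      C (∏ i ∈ s, ((z i : ℤ) : ℝ)) * X ^ hammingDist z 1 = ∏ i, f i (z i) := by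
    intro z
    simp only [f, prod_mul_distrib, prod_ite_mem, univ_inter, map_prod]
    rw [← prod_filter, prod_const]
    rfl
  have hsum : ∀ i, ∑ u, f i u = if i ∈ s then 1 - X else 1 + X := by
    intro i
    have hu : (univ : Finset ℤˣ) = {1, -1} := rfl
    have hne : (-1 : ℤˣ) ≠ 1 := by decide
    rw [hu, sum_pair hne.symm]
    by_cases hi : i ∈ s <;> simp [f, hi, hne, sub_eq_add_neg]
  have hcard : #(univ.filter fun i => i ∉ s) = n - #s := by
    rw [filter_notMem_eq_sdiff, card_sdiff_of_subset (subset_univ s), card_univ, Fintype.card_fin]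
  simp only [hf]
  rw [← Fintype.prod_sum]
  simp only [hsum]
  rw [prod_ite, prod_const, prod_const, hcard, filter_mem_eq_inter, univ_inter]

open Polynomial in
/-- Summing a character over the Hamming ball sums the low coefficients of its weight
enumerator. -/
theorem sum_hBall_character {n : ℕ} (r : ℕ) (s : Finset (Fin n)) :
    ∑ z ∈ hBall n r, ∏ i ∈ s, ((z i : ℤ) : ℝ)
      = ∑ m ∈ range (r + 1), ((1 - X) ^ #s * (1 + X) ^ (n - #s) : ℝ[X]).coeff m := by
  rw [← sum_character_mul_X_pow_hammingDist, hBall, sum_filter]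
  simp only [finsetSum_coeff, coeff_C_mul, coeff_X_pow]
  rw [sum_comm]
  refine sum_congr rfl fun z _ => ?_
  simp

theorem card_hBall (n r : ℕ) : #(hBall n r) = ballBinom n r := by
  have h := sum_hBall_character (n := n) r ∅
  simp only [prod_empty, sum_const, nsmul_eq_mul, mul_one, card_empty, pow_zero, one_mul,
    Nat.sub_zero, Polynomial.coeff_one_add_X_pow] at h
  rw [ballBinom]
  exact_mod_cast h

open Polynomial in
theorem sum_coeff_one_sub_X_mul {R : Type*} [Ring R] (p : R[X]) (r : ℕ) :
    ∑ m ∈ range (r + 1), ((1 - X) * p).coeff m = p.coeff r := by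
  induction r with
  | zero => simp [sub_mul]
  | succ r ih => rw [sum_range_succ, ih, sub_mul, one_mul, coeff_sub, coeff_X_mul]; abel

theorem rchoose_natCast (m j : ℕ) : rchoose m j = m.choose j := by
  rw [rchoose, ← descPochhammer_eval_eq_prod_range, descPochhammer_eval_eq_descFactorial,
    Nat.descFactorial_eq_factorial_mul_choose, Nat.cast_mul]
  field_simp

open Polynomial in
theorem kraw_add_natCast (a b r : ℕ) :
    kraw (a + b) r a = ((1 - X) ^ a * (1 + X) ^ b : ℝ[X]).coeff r := by
  have hcoeff : ∀ j, ((1 - X) ^ a : ℝ[X]).coeff j = (-1) ^ j * a.choose j := by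
    intro j
    have h : ((1 - X) ^ a : ℝ[X]) = ((1 + X) ^ a).comp (C (-1) * X) := by
      simp [sub_eq_add_neg]
    rw [h, comp_C_mul_X_coeff, coeff_one_add_X_pow, mul_comm]
  have hb : ((a + b : ℕ) : ℝ) - a = (b : ℕ) := by push_cast; ring
  rw [coeff_mul, Nat.sum_antidiagonal_eq_sum_range_succ_mk, kraw]
  simp only [hb, rchoose_natCast, hcoeff, coeff_one_add_X_pow]

theorem two_mul_card_filter_eq_one_sub_card {α : Type*} (t : Finset α) (g : α → ℤˣ) :
    2 * (#(t.filter fun z => g z = 1) : ℝ) - #t = ∑ z ∈ t, ((g z : ℤ) : ℝ) := by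
  have h : ∀ z ∈ t, ((g z : ℤ) : ℝ) = 2 * (if g z = 1 then 1 else 0) - 1 := by
    intro z _
    rcases Int.units_eq_one_or (g z) with hz | hz
    · norm_num [hz]
    · have hne : (-1 : ℤˣ) ≠ 1 := by decide
      simp [hz, hne]
  rw [sum_congr rfl h, sum_sub_distrib, ← mul_sum, sum_boole]
  simp

/-- Lemma 3, part 2: for `Z` uniform on the Hamming ball `B_r`,
`2·P[Z_1⋯Z_k = 1] − 1 = K_r^{(n−1)}(k−1) / C(n,≤r)`. -/
theorem ball_noise_character (n r k : ℕ) (hn : 1 ≤ n) (hr1 : 1 ≤ r) (hrn : r ≤ n)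
    (hk1 : 1 ≤ k) (hkn : k ≤ n) :
    2 * ((((hBall n r).filter fun z =>
          (∏ i ∈ Finset.univ.filter fun i : Fin n => (i : ℕ) < k, z i) = 1).card : ℝ)
        / ((hBall n r).card : ℝ)) - 1
      = kraw (n - 1) r ((k : ℝ) - 1) / (ballBinom n r : ℝ) := by
  obtain ⟨a, rfl⟩ := Nat.exists_eq_add_of_le' hk1
  obtain ⟨b, rfl⟩ := Nat.exists_eq_add_of_le hkn
  have hs : #(univ.filter fun i : Fin (a + 1 + b) => (i : ℕ) < a + 1) = a + 1 := by
    rw [Fin.card_filter_val_lt]; omega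
  have hball : (ballBinom (a + 1 + b) r : ℝ) ≠ 0 := by
    rw [ballBinom, sum_range_succ', Nat.choose_zero_right]
    positivity
  have key := two_mul_card_filter_eq_one_sub_card (hBall (a + 1 + b) r) fun z =>
    ∏ i ∈ univ.filter fun i : Fin (a + 1 + b) => (i : ℕ) < a + 1, z i
  simp only [Units.coe_prod, Int.cast_prod] at key
  rw [sum_hBall_character, hs, Nat.add_sub_cancel_left, pow_succ', mul_assoc,
    sum_coeff_one_sub_X_mul, ← kraw_add_natCast, card_hBall] at key
  have hn' : a + 1 + b - 1 = a + b := by omega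
  have hk' : ((a + 1 : ℕ) : ℝ) - 1 = a := by push_cast; ring
  rw [card_hBall, hn', hk', ← key]
  field_simp
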